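/- arXiv:1503.00337 — 2 statements merged into one kernel-verified Lean document; each statement's English description precedes it below -/
import Mathlib

section
/- Let n be a natural number and let b, c : Fin n → Fin n → Fin n → ℝ be two tensors. Suppose that b does not lie in the O(n)-orbit of c, i.e. there is no orthogonal matrix U (real n×n matrix with UᵀU = 1) such that b = U • c, where (U • c) i j k = ∑_{a,b',d} U i a * U j b' * U k d * c a b' d. Then there exists a polynomial p in the variables indexed by Fin n × Fin n × Fin n with real coefficients which is O(n)-invariant (meaning eval (U • x) p = eval x p for every orthogonal U and every tensor x) such that eval (U • b) p ≤ 0 for every orthogonal U and eval (U • c) p ≥ 1 for every orthogonal U. -/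
/-- A real `n × n` matrix is orthogonal if `Uᵀ * U = 1`. -/
def IsOrthogonal {n : ℕ} (U : Matrix (Fin n) (Fin n) ℝ) : Prop :=
  U.transpose * U = 1

/-- The action of an `n × n` matrix `U` on a tensor `c : Fin n → Fin n → Fin n → ℝ`:
`(U • c) i j k = ∑ a b d, U i a * U j b * U k d * c a b d`. -/
def matAct {n : ℕ} (U : Matrix (Fin n) (Fin n) ℝ) (c : Fin n → Fin n → Fin n → ℝ) :
    Fin n → Fin n → Fin n → ℝ :=
  fun i j k => ∑ a, ∑ b, ∑ d, U i a * U j b * U k d * c a b d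

/-- Evaluation of a polynomial in the variables `Fin n × Fin n × Fin n` at a tensor. -/
noncomputable def evalTensor {n : ℕ} (c : Fin n → Fin n → Fin n → ℝ)
    (p : MvPolynomial (Fin n × Fin n × Fin n) ℝ) : ℝ :=
  MvPolynomial.eval (fun v => c v.1 v.2.1 v.2.2) p

open MeasureTheory Matrix

/-- Averaging a polynomial against a compact family of linear substitutions of the variables
yields a polynomial. -/
lemma MvPolynomial.exists_eval_eq_integral_mulVec {σ G : Type*} [Fintype σ]
    [TopologicalSpace G] [CompactSpace G] [MeasurableSpace G] [BorelSpace G]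
    (μ : Measure G) [IsFiniteMeasure μ] (L : G → Matrix σ σ ℝ) (hL : Continuous L)
    (p : MvPolynomial σ ℝ) (w : G → ℝ) (hw : Continuous w) :
    ∃ q : MvPolynomial σ ℝ, ∀ x : σ → ℝ,
      MvPolynomial.eval x q = ∫ g, w g * MvPolynomial.eval (L g *ᵥ x) p ∂μ := by
  have integrable {f : G → ℝ} (hf : Continuous f) : Integrable f μ :=
    hf.integrable_of_hasCompactSupport (HasCompactSupport.of_compactSpace f)
  have hcont (p : MvPolynomial σ ℝ) (x : σ → ℝ) :
      Continuous fun g => MvPolynomial.eval (L g *ᵥ x) p :=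
    (MvPolynomial.continuous_eval p).comp (hL.matrix_mulVec continuous_const)
  induction p using MvPolynomial.induction_on generalizing w with
  | C a =>
    exact ⟨MvPolynomial.C (∫ g, w g * a ∂μ), fun x => by simp⟩
  | add p₁ p₂ h₁ h₂ =>
    obtain ⟨q₁, hq₁⟩ := h₁ w hw
    obtain ⟨q₂, hq₂⟩ := h₂ w hw
    refine ⟨q₁ + q₂, fun x => ?_⟩
    simp only [map_add, mul_add, hq₁, hq₂]
    exact (integral_add (integrable (hw.mul (hcont p₁ x))) (integrable (hw.mul (hcont p₂ x)))).symm
  | mul_X p i h =>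
    have hw' (j : σ) : Continuous fun g => w g * L g i j := hw.mul (hL.matrix_elem i j)
    choose q hq using fun j => h (fun g => w g * L g i j) (hw' j)
    refine ⟨∑ j, q j * MvPolynomial.X j, fun x => ?_⟩
    simp only [map_sum, map_mul, MvPolynomial.eval_X, hq, ← integral_mul_const]
    refine (integral_finsetSum _ fun j _ =>
      integrable (((hw' j).mul (hcont p x)).mul continuous_const)).symm.trans ?_
    refine integral_congr_ae (ae_of_all _ fun g => ?_)
    simp only [mulVec, dotProduct, Finset.mul_sum]
    exact Finset.sum_congr rfl fun j _ => by simp only [Pi.mul_apply]; ring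

/-- On a compact set, continuous functions are uniformly approximated by polynomials. -/
lemma MvPolynomial.exists_near_continuousMap_of_isCompact {σ : Type*} (f : C(σ → ℝ, ℝ))
    {K : Set (σ → ℝ)} (hK : IsCompact K) {ε : ℝ} (hε : 0 < ε) :
    ∃ p : MvPolynomial σ ℝ, ∀ x ∈ K, |MvPolynomial.eval x p - f x| < ε := by
  let coord (i : σ) : C(σ → ℝ, ℝ) := ⟨fun x => x i, continuous_apply i⟩
  let φ : MvPolynomial σ ℝ →ₐ[ℝ] C(σ → ℝ, ℝ) := MvPolynomial.aeval coord
  have hφ (p : MvPolynomial σ ℝ) (x : σ → ℝ) : φ p x = MvPolynomial.eval x p := by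
    induction p using MvPolynomial.induction_on with
    | C a => simp [φ]
    | add p q hp hq => simp [hp, hq]
    | mul_X p i hp => simp [hp, φ, coord]
  have hsep : φ.range.SeparatesPoints := by
    intro x y hxy
    obtain ⟨i, hi⟩ := Function.ne_iff.mp hxy
    exact ⟨coord i, ⟨coord i, ⟨MvPolynomial.X i, by simp [φ]⟩, rfl⟩, hi⟩
  obtain ⟨_, ⟨p, rfl⟩, hp⟩ :=
    ContinuousMap.exists_mem_subalgebra_near_continuous_of_isCompact_of_separatesPoints
      hsep f hK hε
  refine ⟨p, fun x hx => ?_⟩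
  rw [← hφ]
  exact hp x hx

/-- Invariant polynomials separate the orbits of a compact group acting linearly. -/
lemma MvPolynomial.exists_invariant_separating {σ G : Type*} [Fintype σ] [DecidableEq σ] [Group G]
    [TopologicalSpace G] [IsTopologicalGroup G] [CompactSpace G]
    (ρ : G →* Matrix σ σ ℝ) (hρ : Continuous ρ) (b c : σ → ℝ) (h : ∀ g, b ≠ ρ g *ᵥ c) :
    ∃ p : MvPolynomial σ ℝ,
      (∀ g x, MvPolynomial.eval (ρ g *ᵥ x) p = MvPolynomial.eval x p) ∧
      MvPolynomial.eval b p ≤ 0 ∧ 1 ≤ MvPolynomial.eval c p := by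
  have horb (x : σ → ℝ) : Continuous fun g => ρ g *ᵥ x := hρ.matrix_mulVec continuous_const
  have hB := isCompact_range (horb b)
  have hC := isCompact_range (horb c)
  have hd : Disjoint (Set.range fun g => ρ g *ᵥ b) (Set.range fun g => ρ g *ᵥ c) := by
    rw [Set.disjoint_left]
    rintro _ ⟨g, rfl⟩ ⟨k, hk⟩
    refine h (g⁻¹ * k) ?_
    have hk : ρ k *ᵥ c = ρ g *ᵥ b := hk
    rw [map_mul, ← mulVec_mulVec, hk, mulVec_mulVec, ← map_mul, inv_mul_cancel, map_one,
      one_mulVec]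
  obtain ⟨f, hfb, hfc, -⟩ := exists_continuous_zero_one_of_isClosed hB.isClosed hC.isClosed hd
  obtain ⟨p, hp⟩ := exists_near_continuousMap_of_isCompact f (hB.union hC)
    (show (0 : ℝ) < 1 / 4 by norm_num)
  borelize G
  let μ : Measure G := Measure.haarMeasure ⊤
  have : IsProbabilityMeasure μ := ⟨by
    simpa using Measure.haarMeasure_self (K₀ := (⊤ : TopologicalSpace.PositiveCompacts G))⟩
  obtain ⟨q, hq⟩ := exists_eval_eq_integral_mulVec μ (fun g => ρ g⁻¹)
    (hρ.comp continuous_inv) p (fun _ => 1) continuous_const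
  simp only [one_mul] at hq
  have hint (x : σ → ℝ) : Integrable (fun g => MvPolynomial.eval (ρ g⁻¹ *ᵥ x) p) μ :=
    Continuous.integrable_of_hasCompactSupport
      ((MvPolynomial.continuous_eval p).comp ((horb x).comp continuous_inv))
      (HasCompactSupport.of_compactSpace _)
  have hinv (g : G) (x : σ → ℝ) :
      MvPolynomial.eval (ρ g *ᵥ x) q = MvPolynomial.eval x q := by
    rw [hq, hq, ← integral_mul_left_eq_self _ g]
    simp [mulVec_mulVec, ← map_mul, mul_assoc]
  have hqb : MvPolynomial.eval b q ≤ 1 / 4 := by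
    rw [hq]
    refine (integral_mono (hint b) (integrable_const (1 / 4 : ℝ)) fun g => ?_).trans_eq (by simp)
    have h₁ := hp _ (Or.inl ⟨g⁻¹, rfl⟩)
    have h₂ : f (ρ g⁻¹ *ᵥ b) = 0 := hfb ⟨g⁻¹, rfl⟩
    simp only [h₂] at h₁
    linarith [(abs_lt.mp h₁).2]
  have hqc : 3 / 4 ≤ MvPolynomial.eval c q := by
    rw [hq]
    refine Eq.trans_le (by simp) (integral_mono (integrable_const (3 / 4 : ℝ)) (hint c) fun g => ?_)
    have h₁ := hp _ (Or.inr ⟨g⁻¹, rfl⟩)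
    have h₂ : f (ρ g⁻¹ *ᵥ c) = 1 := hfc ⟨g⁻¹, rfl⟩
    simp only [h₂] at h₁
    linarith [(abs_lt.mp h₁).1]
  refine ⟨MvPolynomial.C 2 * q - MvPolynomial.C (1 / 2), fun g x => ?_, ?_, ?_⟩
  · simp [hinv]
  · simp only [map_sub, map_mul, MvPolynomial.eval_C]
    linarith
  · simp only [map_sub, map_mul, MvPolynomial.eval_C]
    linarith

lemma Matrix.isCompact_orthogonalGroup (m : Type*) [Fintype m] [DecidableEq m] :
    IsCompact (orthogonalGroup m ℝ : Set (Matrix m m ℝ)) := by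
  have hK : IsCompact (Set.univ.pi fun _ : m => Set.univ.pi fun _ : m => Set.Icc (-1 : ℝ) 1) :=
    isCompact_univ_pi fun _ => isCompact_univ_pi fun _ => isCompact_Icc
  refine hK.of_isClosed_subset (isClosed_unitary (R := Matrix m m ℝ)) fun U hU i _ j _ => ?_
  exact abs_le.mp (entry_norm_bound_of_unitary hU i j)

/-- The third tensor power of the standard representation of the orthogonal group. -/
def tensorCubeRep (m : Type*) [Fintype m] [DecidableEq m] :
    orthogonalGroup m ℝ →* Matrix (m × m × m) (m × m × m) ℝ where
  toFun U := kronecker U.1 (kronecker U.1 U.1)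
  map_one' := by simp [kronecker]
  map_mul' U V := by simp [kronecker, mul_kronecker_mul]

lemma continuous_tensorCubeRep (m : Type*) [Fintype m] [DecidableEq m] :
    Continuous (tensorCubeRep m) := by
  refine continuous_matrix fun i j => ?_
  have h (i j : m) : Continuous fun U : orthogonalGroup m ℝ => U.1 i j :=
    continuous_subtype_val.matrix_elem i j
  exact (h _ _).mul ((h _ _).mul (h _ _))

lemma tensorCubeRep_mulVec {n : ℕ} (U : orthogonalGroup (Fin n) ℝ)
    (c : Fin n → Fin n → Fin n → ℝ) :
    tensorCubeRep (Fin n) U *ᵥ (fun v => c v.1 v.2.1 v.2.2) =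
      fun v => matAct U.1 c v.1 v.2.1 v.2.2 := by
  ext ⟨i, j, k⟩
  simp [tensorCubeRep, mulVec, dotProduct, matAct, Fintype.sum_prod_type, mul_assoc]

lemma IsOrthogonal.mem_orthogonalGroup {n : ℕ} {U : Matrix (Fin n) (Fin n) ℝ}
    (hU : IsOrthogonal U) : U ∈ orthogonalGroup (Fin n) ℝ :=
  (mem_orthogonalGroup_iff' _ _).mpr hU

theorem stmt0 (n : ℕ) (b c : Fin n → Fin n → Fin n → ℝ)
    (h : ¬ ∃ U : Matrix (Fin n) (Fin n) ℝ, IsOrthogonal U ∧ b = matAct U c) :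
    ∃ p : MvPolynomial (Fin n × Fin n × Fin n) ℝ,
      (∀ (U : Matrix (Fin n) (Fin n) ℝ) (x : Fin n → Fin n → Fin n → ℝ),
        IsOrthogonal U → evalTensor (matAct U x) p = evalTensor x p) ∧
      (∀ U : Matrix (Fin n) (Fin n) ℝ, IsOrthogonal U → evalTensor (matAct U b) p ≤ 0) ∧
      (∀ U : Matrix (Fin n) (Fin n) ℝ, IsOrthogonal U → 1 ≤ evalTensor (matAct U c) p) := by
  have : CompactSpace (orthogonalGroup (Fin n) ℝ) :=
    isCompact_iff_compactSpace.mp (isCompact_orthogonalGroup (Fin n))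
  have : IsTopologicalGroup (orthogonalGroup (Fin n) ℝ) :=
    inferInstanceAs (IsTopologicalGroup (unitary (Matrix (Fin n) (Fin n) ℝ)))
  obtain ⟨p, hinv, hb, hc⟩ := MvPolynomial.exists_invariant_separating
    (tensorCubeRep (Fin n)) (continuous_tensorCubeRep (Fin n))
    (fun v => b v.1 v.2.1 v.2.2) (fun v => c v.1 v.2.1 v.2.2) fun U hU => by
      rw [tensorCubeRep_mulVec] at hU
      refine h ⟨U.1, (mem_orthogonalGroup_iff' _ _).mp U.2, ?_⟩
      ext i j k
      exact congrFun hU (i, j, k)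
  have hinv' (U : Matrix (Fin n) (Fin n) ℝ) (x : Fin n → Fin n → Fin n → ℝ)
      (hU : IsOrthogonal U) : evalTensor (matAct U x) p = evalTensor x p := by
    have := hinv ⟨U, hU.mem_orthogonalGroup⟩ (fun v => x v.1 v.2.1 v.2.2)
    rwa [tensorCubeRep_mulVec] at this
  exact ⟨p, hinv', fun U hU => (hinv' U b hU).trans_le hb, fun U hU => (hinv' U c hU).symm ▸ hc⟩
end

section
/- Let k ≥ 1 and x ∈ ℝ. Then |Q| · μ(x) is an eigenvalue of the matrix A^Q(x): there exists a nonzero real vector u indexed by the perfect matchings on Fin (6k) such that A^Q(x) · u = (|Q| · μ(x)) • u, where μ(x) = ∏_{i=0}^{k-1} (x - i)(x - i + 2)(x + 2i + 4) and |Q| is the cardinality of the group Q. -/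
/-- A perfect matching on `Fin (6*k)`: a fixed-point-free involution. -/
def IsPM {m : ℕ} (M : Equiv.Perm (Fin m)) : Prop :=
  M * M = 1 ∧ ∀ a, M a ≠ a

/-- `numOrbits M N` is the number of orbits on `Fin m` of the subgroup of
`Equiv.Perm (Fin m)` generated by `{M, N}`. -/
noncomputable def numOrbits {m : ℕ} (M N : Equiv.Perm (Fin m)) : ℕ :=
  Nat.card (MulAction.orbitRel.Quotient (Subgroup.closure {M, N}) (Fin m))

noncomputable instance (m : ℕ) : Fintype {M : Equiv.Perm (Fin m) // IsPM M} :=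
  Fintype.ofFinite _

/-- The `i`-th element (for `i : Fin 3`) of the `j`-th block (for `j : Fin (2*k)`);
in 1-indexed labels this is the element `3*j - (2 - i)` of the block `{3j-2, 3j-1, 3j}`. -/
def blk {k : ℕ} (j : Fin (2 * k)) (i : Fin 3) : Fin (6 * k) :=
  ⟨3 * j.val + i.val, by have := j.isLt; have := i.isLt; omega⟩

/-- The group `B = B₁B₂⋯B_{2k}`, where `B_j` is the cyclic group generated by the
3-cycle `(3j-2, 3j-1, 3j)`: on each block, `b` acts as a cyclic rotation. -/
def Bset (k : ℕ) : Set (Equiv.Perm (Fin (6 * k))) :=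
  {b | ∀ j : Fin (2 * k), ∃ s : Fin 3, ∀ i : Fin 3, b (blk j i) = blk j (i + s)}

/-- The group `D` of permutations permuting the blocks while preserving positions
inside each block. -/
def Dset (k : ℕ) : Set (Equiv.Perm (Fin (6 * k))) :=
  {d | ∃ π : Equiv.Perm (Fin (2 * k)), ∀ (j : Fin (2 * k)) (i : Fin 3), d (blk j i) = blk (π j) i}

/-- The group `Q = BD`. -/
def Qset (k : ℕ) : Set (Equiv.Perm (Fin (6 * k))) :=
  {q | ∃ b ∈ Bset k, ∃ d ∈ Dset k, q = b * d}

noncomputable def Qfin (k : ℕ) : Finset (Equiv.Perm (Fin (6 * k))) :=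
  (Set.toFinite (Qset k)).toFinset

/-- The matrix `A^Q(x)`, indexed by the perfect matchings on `Fin (6*k)`, with entries
`A^Q(x)_{M,N} = ∑_{q ∈ Q} x ^ c(M, q·N)` where `q · N = q N q⁻¹`. -/
noncomputable def AQ (k : ℕ) (x : ℝ) :
    Matrix {M : Equiv.Perm (Fin (6 * k)) // IsPM M} {M : Equiv.Perm (Fin (6 * k)) // IsPM M} ℝ :=
  Matrix.of fun M N => ∑ q ∈ Qfin k, x ^ numOrbits M.1 (q * N.1 * q⁻¹)

/-- `μ(x) = ∏_{i=0}^{k-1} (x - i)(x - i + 2)(x + 2i + 4)`. -/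
noncomputable def muPoly (k : ℕ) (x : ℝ) : ℝ :=
  ∏ i ∈ Finset.range k, (x - (i : ℝ)) * (x - (i : ℝ) + 2) * (x + 2 * (i : ℝ) + 4)

open Finset

/-- The number of fixed-point-free involutions of an `n`-element set, which is also the `n`-th
moment of a standard Gaussian variable. -/
def gaussMoment : ℕ → ℕ
  | 0 => 1
  | 1 => 0
  | n + 2 => (n + 1) * gaussMoment n

theorem gaussMoment_succ (n : ℕ) : gaussMoment (n + 1) = n * gaussMoment (n - 1) := by
  cases n <;> simp [gaussMoment]

theorem gaussMoment_two_mul (n : ℕ) :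
    gaussMoment (2 * n) * (2 ^ n * n.factorial) = (2 * n).factorial := by
  induction n with
  | zero => simp [gaussMoment]
  | succ n ih =>
    rw [show 2 * (n + 1) = 2 * n + 2 by ring, gaussMoment, Nat.factorial_succ (2 * n + 1),
      Nat.factorial_succ (2 * n), ← ih, Nat.factorial_succ n]
    ring

theorem gaussMoment_two_mul_add_one (n : ℕ) : gaussMoment (2 * n + 1) = 0 := by
  induction n with
  | zero => rfl
  | succ n ih => rw [show 2 * (n + 1) + 1 = 2 * n + 1 + 2 by ring, gaussMoment, ih, mul_zero]

theorem involution_iff_cycleType {α : Type*} [Fintype α] [DecidableEq α] (M : Equiv.Perm α) :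
    (M * M = 1 ∧ ∀ a, M a ≠ a) ↔
      ∃ n, Fintype.card α = 2 * n ∧ M.cycleType = Multiset.replicate n 2 := by
  constructor
  · rintro ⟨h, h'⟩
    have : Fact (Nat.Prime 2) := ⟨Nat.prime_two⟩
    have hc := Equiv.Perm.cycleType_of_pow_prime_eq_one (p := 2) (σ := M) (by rw [sq, h])
    have hs : M.support = univ := by ext; simp [h']
    have := M.sum_cycleType
    refine ⟨_, ?_, hc⟩
    rw [hc, hs, Multiset.sum_replicate, card_univ, smul_eq_mul] at this
    omega
  · rintro ⟨n, hn, hM⟩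
    have hs := M.sum_cycleType
    rw [hM, Multiset.sum_replicate, smul_eq_mul, mul_comm, ← hn, eq_comm,
      Finset.card_eq_iff_eq_univ] at hs
    constructor
    · have : M ^ 2 = 1 := by
        rw [Equiv.Perm.pow_prime_eq_one_iff, hM]
        exact fun c hc => Multiset.eq_of_mem_replicate hc
      rwa [sq] at this
    · intro a
      rw [← Equiv.Perm.mem_support, hs]
      exact mem_univ a

theorem card_involution (α : Type*) [Fintype α] [DecidableEq α] :
    Fintype.card {M : Equiv.Perm α // M * M = 1 ∧ ∀ a, M a ≠ a} =
      gaussMoment (Fintype.card α) := by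
  obtain ⟨n, hn | hn⟩ := Nat.even_or_odd' (Fintype.card α)
  · have h : ∀ M : Equiv.Perm α, (M * M = 1 ∧ ∀ a, M a ≠ a) ↔
        M.cycleType = Multiset.replicate n 2 := fun M => by
      rw [involution_iff_cycleType]
      constructor
      · rintro ⟨m, hm, h⟩
        rwa [show n = m by omega]
      · exact fun h => ⟨n, hn, h⟩
    have key := Equiv.Perm.card_of_cycleType_mul_eq α (Multiset.replicate n 2)
    rw [if_pos ⟨by simp [hn, mul_comm], fun a ha => (Multiset.eq_of_mem_replicate ha).ge⟩] at key
    have hp : ∏ m ∈ (Multiset.replicate n 2).toFinset, ((Multiset.replicate n 2).count m).factorial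
        = n.factorial := by
      rcases Nat.eq_zero_or_pos n with rfl | h0
      · simp
      · rw [Multiset.toFinset_replicate, if_neg h0.ne']
        simp
    rw [hp, Multiset.sum_replicate, Multiset.prod_replicate, hn, smul_eq_mul, mul_comm n 2,
      Nat.sub_self, Nat.factorial_zero, one_mul, ← gaussMoment_two_mul] at key
    rw [Fintype.card_subtype, hn, ← Nat.eq_of_mul_eq_mul_right (by positivity) key]
    simp only [h]
  · rw [hn, gaussMoment_two_mul_add_one, Fintype.card_eq_zero_iff, isEmpty_subtype]
    intro M hM
    obtain ⟨m, hm, -⟩ := (involution_iff_cycleType M).1 hM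
    omega

/-- Involutions preserving `t` are families of involutions of the fibres of `t`. -/
def involutionFiberEquiv {α V : Type*} (t : α → V) :
    {M : Equiv.Perm α // (M * M = 1 ∧ ∀ a, M a ≠ a) ∧ ∀ a, t (M a) = t a} ≃
      ∀ v, {M : Equiv.Perm {a // t a = v} // M * M = 1 ∧ ∀ a, M a ≠ a} where
  toFun M v := ⟨M.1.subtypePerm fun a => by rw [M.2.2], by
    obtain ⟨M, ⟨h, h'⟩, ht⟩ := M
    refine ⟨?_, fun a ha => h' a (congrArg Subtype.val ha)⟩
    ext a
    exact congrArg (fun σ : Equiv.Perm α => σ a) h⟩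
  invFun g := ⟨(Equiv.sigmaFiberEquiv t).permCongr (Equiv.sigmaCongrRight fun v => (g v).1), by
    refine ⟨⟨?_, fun a ha => (g (t a)).2.2 ⟨a, rfl⟩ (Subtype.ext ha)⟩,
      fun a => ((g (t a)).1 ⟨a, rfl⟩).2⟩
    have h : (fun v => (g v).1) * (fun v => (g v).1) = 1 := funext fun v => (g v).2.1
    rw [← Equiv.permCongr_mul, Equiv.Perm.sigmaCongrRight_mul, h, Equiv.Perm.sigmaCongrRight_one]
    exact map_one (Equiv.sigmaFiberEquiv t).permCongrHom⟩
  left_inv M := by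
    ext a
    rfl
  right_inv g := by
    ext v ⟨a, rfl⟩
    rfl

theorem card_involution_preserving {α V : Type*} [Fintype α] [Fintype V]
    [DecidableEq V] (t : α → V) :
    Nat.card {M : Equiv.Perm α // (M * M = 1 ∧ ∀ a, M a ≠ a) ∧ ∀ a, t (M a) = t a} =
      ∏ v, gaussMoment #{a | t a = v} := by
  classical
  rw [Nat.card_congr (involutionFiberEquiv t), Nat.card_pi]
  refine prod_congr rfl fun v _ => ?_
  rw [Nat.card_eq_fintype_card, card_involution, Fintype.card_subtype]

/-- The formal expectation over independent standard Gaussian variables indexed by `V`. -/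
noncomputable def gaussE (V : Type*) [Fintype V] : MvPolynomial V ℝ →ₗ[ℝ] ℝ :=
  (MvPolynomial.basisMonomials V ℝ).constr ℝ fun s => ∏ v, (gaussMoment (s v) : ℝ)

section GaussE

open MvPolynomial

variable {V : Type*} [Fintype V]

theorem gaussE_monomial (s : V →₀ ℕ) (c : ℝ) :
    gaussE V (monomial s c) = c * ∏ v, (gaussMoment (s v) : ℝ) := by
  have h : monomial s c = c • basisMonomials V ℝ s := by simp [smul_monomial]
  rw [h, map_smul, gaussE, Module.Basis.constr_basis, smul_eq_mul]

theorem gaussE_X_mul (v : V) (P : MvPolynomial V ℝ) :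
    gaussE V (X v * P) = gaussE V (pderiv v P) := by
  classical
  induction P using MvPolynomial.induction_on' with
  | add p q hp hq => rw [mul_add, map_add, map_add, map_add, hp, hq]
  | monomial s c =>
    rw [X, monomial_mul, pderiv_monomial, gaussE_monomial, gaussE_monomial,
      ← mul_prod_erase univ _ (mem_univ v), ← mul_prod_erase univ _ (mem_univ v)]
    have h1 : ∀ w ∈ univ.erase v, (Finsupp.single v 1 + s : V →₀ ℕ) w =
        (s - Finsupp.single v 1 : V →₀ ℕ) w := by
      intro w hw
      simp [(ne_of_mem_erase hw).symm]
    rw [prod_congr rfl fun w hw => by rw [h1 w hw]]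
    have h2 : (Finsupp.single v 1 + s : V →₀ ℕ) v = s v + 1 := by simp [add_comm]
    have h3 : (s - Finsupp.single v 1 : V →₀ ℕ) v = s v - 1 := by simp
    rw [h2, h3, gaussMoment_succ]
    push_cast
    ring

theorem gaussE_prod_X [DecidableEq V] {α : Type*} [Fintype α] [DecidableEq α] (t : α → V) :
    gaussE V (∏ a, X (t a)) = ∏ v, (gaussMoment #{a | t a = v} : ℝ) := by
  have h : ∏ a, X (t a) = monomial (R := ℝ) (∑ a, Finsupp.single (t a) 1) 1 := by
    rw [monomial_sum_one]
    rfl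
  rw [h, gaussE_monomial, one_mul]
  refine prod_congr rfl fun v _ => ?_
  rw [Finsupp.finsetSum_apply, card_filter]
  simp only [Finsupp.single_apply]

/-- Wick's formula. -/
theorem gaussE_prod_X_eq_sum [DecidableEq V] {m : ℕ} (t : Fin m → V) :
    gaussE V (∏ a, X (t a)) =
      ∑ M : {M : Equiv.Perm (Fin m) // IsPM M}, if ∀ a, t (M.1 a) = t a then 1 else 0 := by
  rw [gaussE_prod_X, ← Nat.cast_prod, ← card_involution_preserving, sum_boole, Nat.cast_inj,
    ← Fintype.card_subtype, ← Nat.card_eq_fintype_card]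
  exact Nat.card_congr (Equiv.subtypeSubtypeEquivSubtypeInter IsPM _).symm

end GaussE

theorem Derivation.map_prod {ι R A : Type*} [CommSemiring R] [CommRing A] [Algebra R A]
    [DecidableEq ι] (D : Derivation R A A) (s : Finset ι) (f : ι → A) :
    D (∏ i ∈ s, f i) = ∑ i ∈ s, (∏ j ∈ s.erase i, f j) * D (f i) := by
  induction s using Finset.induction_on with
  | empty => simp
  | insert a s ha ih =>
    rw [prod_insert ha, D.leibniz, ih, sum_insert ha, erase_insert ha, add_comm]
    simp only [smul_eq_mul, mul_sum, ← mul_assoc]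
    congr 1
    refine sum_congr rfl fun i hi => ?_
    rw [erase_insert_of_ne (by rintro rfl; exact ha hi),
      prod_insert (fun h => ha (mem_of_mem_erase h))]

/-- Jacobi's formula for derivations. -/
theorem Derivation.map_det {n R A : Type*} [Fintype n] [DecidableEq n] [CommSemiring R]
    [CommRing A] [Algebra R A] (D : Derivation R A A) (M : Matrix n n A) :
    D M.det = ∑ j, ∑ i, M.adjugate j i * D (M i j) := by
  have h : ∀ j, ∑ i, M.adjugate j i * D (M i j) = (M.updateCol j fun i => D (M i j)).det := by
    intro j
    rw [← Matrix.cramer_apply, Matrix.cramer_eq_adjugate_mulVec]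
    rfl
  simp only [h, Matrix.det_apply', _root_.map_sum]
  rw [sum_comm]
  refine sum_congr rfl fun σ _ => ?_
  have hs : D ((Equiv.Perm.sign σ : ℤ) : A) = 0 := by
    rw [← zsmul_one, D.map_smul_of_tower, D.map_one_eq_zero, smul_zero]
  rw [D.leibniz, hs, smul_zero, add_zero, D.map_prod, smul_eq_mul, mul_sum]
  refine sum_congr rfl fun j _ => ?_
  rw [← prod_erase_mul univ _ (mem_univ j), Matrix.updateCol_self]
  congr 2
  refine prod_congr rfl fun i hi => ?_
  rw [Matrix.updateCol_ne (ne_of_mem_erase hi)]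

section RowOperator

open MvPolynomial

variable {ι κ : Type*} [Fintype κ]

/-- The matrix of inner products of the rows of the generic matrix. -/
noncomputable def genericGram (ι κ : Type*) [Fintype κ] :
    Matrix ι ι (MvPolynomial (ι × κ) ℝ) :=
  Matrix.of fun i j => ∑ l, X (i, l) * X (j, l)

/-- The derivation replacing an occurrence of row `s` by row `j`. -/
noncomputable def rowD (κ : Type*) [Fintype κ] (j s : ι) :
    Derivation ℝ (MvPolynomial (ι × κ) ℝ) (MvPolynomial (ι × κ) ℝ) :=
  ∑ l, (X (j, l) : MvPolynomial (ι × κ) ℝ) • pderiv (s, l)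

theorem rowD_apply (j s : ι) (P : MvPolynomial (ι × κ) ℝ) :
    rowD κ j s P = ∑ l, X (j, l) * pderiv (s, l) P := by
  rw [rowD, ← Derivation.coeFnAddMonoidHom_apply, map_sum, Finset.sum_apply]
  rfl

theorem rowD_X [DecidableEq ι] (j s i : ι) (l : κ) :
    rowD κ j s (X (i, l)) = if i = s then X (j, l) else 0 := by
  classical
  rw [rowD_apply]
  simp only [pderiv_X, Pi.single_apply, Prod.mk.injEq]
  by_cases h : i = s <;> simp [h]

theorem rowD_genericGram [DecidableEq ι] (j s a b : ι) :
    rowD κ j s (genericGram ι κ a b) =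
      (if a = s then genericGram ι κ j b else 0) + if b = s then genericGram ι κ a j else 0 := by
  simp only [genericGram, Matrix.of_apply, map_sum, Derivation.leibniz, rowD_X, smul_eq_mul,
    sum_add_distrib]
  rw [add_comm]
  congr 1 <;> split_ifs <;> simp [mul_comm]

theorem rowD_det_genericGram [Fintype ι] [DecidableEq ι] (j s : ι) :
    rowD κ j s (genericGram ι κ).det = if j = s then 2 * (genericGram ι κ).det else 0 := by
  have hsymm : ∀ a b, genericGram ι κ a b = genericGram ι κ b a := fun a b => by
    simp [genericGram, mul_comm]
  rw [Derivation.map_det]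
  simp only [rowD_genericGram, mul_add, sum_add_distrib, mul_ite, mul_zero, sum_ite_eq',
    mem_univ, if_true]
  have h1 := congrFun (congrFun (genericGram ι κ).mul_adjugate j) s
  have h2 := congrFun (congrFun (genericGram ι κ).adjugate_mul s) j
  simp only [Matrix.mul_apply, Matrix.smul_apply, Matrix.one_apply, smul_eq_mul] at h1 h2
  have h3 : ∑ a, ∑ b, (if a = s then (genericGram ι κ).adjugate a b * genericGram ι κ b j else 0)
      = ∑ b, (genericGram ι κ).adjugate s b * genericGram ι κ b j := by
    rw [sum_comm]
    simp
  rw [h3, h2]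
  simp only [mul_comm _ (genericGram ι κ j _), h1]
  by_cases h : j = s
  · simp [h, two_mul]
  · simp [h, Ne.symm h]

theorem gaussE_genericGram_mul [Fintype ι] [DecidableEq ι] (s j : ι)
    (P : MvPolynomial (ι × κ) ℝ) :
    gaussE (ι × κ) (genericGram ι κ s j * P) =
      (if j = s then (Fintype.card κ : ℝ) * gaussE (ι × κ) P else 0) +
        gaussE (ι × κ) (rowD κ j s P) := by
  classical
  have h : ∀ l, pderiv (s, l) (X (j, l) : MvPolynomial (ι × κ) ℝ) = if j = s then 1 else 0 := by
    intro l
    simp only [pderiv_X, Pi.single_apply, Prod.mk.injEq, and_true]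
  simp only [genericGram, Matrix.of_apply, sum_mul, map_sum, mul_assoc, gaussE_X_mul,
    Derivation.leibniz, map_add, smul_eq_mul, h, rowD_apply, sum_add_distrib]
  rw [add_comm]
  congr 1
  split_ifs <;> simp

/-- Integrating out the last row of a leading principal minor. -/
theorem gaussE_det_submatrix_mul [Fintype ι] [DecidableEq ι] {n : ℕ} (f : Fin (n + 1) → ι)
    (hf : Function.Injective f) (w : ℝ) (P : MvPolynomial (ι × κ) ℝ)
    (hP : ∀ j, rowD κ (f j) (f (Fin.last n)) P = if j = Fin.last n then C w * P else 0) :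
    gaussE (ι × κ) (((genericGram ι κ).submatrix f f).det * P) =
      (Fintype.card κ + w - n) * gaussE (ι × κ)
        (((genericGram ι κ).submatrix (f ∘ Fin.castSucc) (f ∘ Fin.castSucc)).det * P) := by
  set A := (genericGram ι κ).submatrix f f with hA
  set m := ((genericGram ι κ).submatrix (f ∘ Fin.castSucc) (f ∘ Fin.castSucc)).det with hm
  have hm' : A.adjugate (Fin.last n) (Fin.last n) = m := by
    rw [Matrix.adjugate_fin_succ_eq_det_submatrix]
    simp [hA, hm, ← two_mul, Function.comp_def]
  have hD : ∀ j, rowD κ (f j) (f (Fin.last n)) (A.adjugate j (Fin.last n)) =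
      (if j = Fin.last n then m else 0) - m := by
    intro j
    set B := A.updateRow (Fin.last n) (Pi.single j 1) with hB
    have hBm : B.adjugate (Fin.last n) (Fin.last n) = m := by
      rw [Matrix.adjugate_apply, hB, Matrix.updateRow_idem, ← Matrix.adjugate_apply, hm']
    have hdB : ∀ a b, rowD κ (f j) (f (Fin.last n)) (B a b) =
        if b = Fin.last n then B a j - (if a = Fin.last n then 1 else 0) else 0 := by
      intro a b
      by_cases ha : a = Fin.last n
      · subst ha
        simp only [hB, Matrix.updateRow_self, Pi.single_apply]
        split_ifs <;> simp_all
      · simp only [hB, Matrix.updateRow_ne ha, hA, Matrix.submatrix_apply, rowD_genericGram,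
          hf.eq_iff, ha, if_false, zero_add, sub_zero]
    rw [Matrix.adjugate_apply, ← hB, Derivation.map_det]
    have h1 := congrFun (congrFun B.adjugate_mul (Fin.last n)) j
    simp only [Matrix.mul_apply, Matrix.smul_apply, Matrix.one_apply, smul_eq_mul] at h1
    simp only [hdB, mul_ite, mul_zero]
    rw [sum_comm]
    simp only [sum_ite_eq', mem_univ, if_true, mul_sub, sum_sub_distrib, h1, mul_ite, mul_one,
      mul_zero, hBm]
    congr 1
    by_cases h : j = Fin.last n
    · subst h
      simp only [if_true, hB]
      rw [← Matrix.adjugate_apply, hm']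
    · rw [if_neg h, if_neg (Ne.symm h)]
  have hexp : A.det * P = ∑ j, A (Fin.last n) j * (A.adjugate j (Fin.last n) * P) := by
    rw [Matrix.det_eq_sum_mul_adjugate_row A (Fin.last n), sum_mul]
    simp only [mul_assoc]
  have hterm : ∀ j, gaussE (ι × κ) (A (Fin.last n) j * (A.adjugate j (Fin.last n) * P)) =
      (if j = Fin.last n then (Fintype.card κ + w + 1) * gaussE (ι × κ) (m * P) else 0)
        - gaussE (ι × κ) (m * P) := by
    intro j
    rw [hA, Matrix.submatrix_apply, ← hA, gaussE_genericGram_mul, Derivation.leibniz, hP, hD]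
    simp only [hf.eq_iff, smul_eq_mul]
    by_cases h : j = Fin.last n
    · subst h
      simp only [if_true, hm', sub_self, mul_zero, add_zero]
      rw [mul_left_comm, C_mul', map_smul, smul_eq_mul]
      ring
    · simp only [h, if_false, mul_zero, zero_add, zero_sub, map_neg, mul_comm P, neg_mul]
  rw [hexp, map_sum, sum_congr rfl fun j _ => hterm j, sum_sub_distrib]
  simp
  ring

theorem gaussE_det_mul {n : ℕ} (w e : ℝ) (P : MvPolynomial (Fin (n + 1) × κ) ℝ)
    (hP : ∀ j s, s ≠ 0 → rowD κ j s P = if j = s then C w * P else 0)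
    (hP0 : rowD κ 0 0 P = C (w + e) * P) :
    gaussE (Fin (n + 1) × κ) ((genericGram (Fin (n + 1)) κ).det * P) =
      (∏ s ∈ range n, (Fintype.card κ + w - (s + 1))) * (Fintype.card κ + w + e) *
        gaussE (Fin (n + 1) × κ) P := by
  have key : ∀ m (hm : m + 1 ≤ n + 1), gaussE (Fin (n + 1) × κ)
      (((genericGram (Fin (n + 1)) κ).submatrix (Fin.castLE hm) (Fin.castLE hm)).det * P) =
      (∏ s ∈ range m, (Fintype.card κ + w - (s + 1))) * (Fintype.card κ + w + e) *
        gaussE (Fin (n + 1) × κ) P := by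
    intro m
    induction m with
    | zero =>
      intro hm
      rw [gaussE_det_submatrix_mul _ (Fin.castLE_injective hm) (w + e)]
      · simp [add_assoc]
      · intro j
        rw [show j = Fin.last 0 from Fin.ext (by omega), if_pos rfl]
        exact hP0
    | succ m ih =>
      intro hm
      rw [gaussE_det_submatrix_mul _ (Fin.castLE_injective hm) w]
      · rw [show (Fin.castLE hm ∘ Fin.castSucc) = Fin.castLE (by omega : m + 1 ≤ n + 1) from rfl,
          ih, prod_range_succ]
        push_cast
        ring
      · intro j
        rw [hP _ _ (by simp [Fin.ext_iff])]
        simp only [(Fin.castLE_injective hm).eq_iff]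
  exact key n le_rfl

theorem gaussE_det_sq_mul {n : ℕ} (e : ℝ) (g : MvPolynomial (Fin (n + 1) × κ) ℝ)
    (hg : ∀ j s, s ≠ 0 → rowD κ j s g = 0) (hg0 : rowD κ 0 0 g = C e * g) :
    gaussE (Fin (n + 1) × κ) ((genericGram (Fin (n + 1)) κ).det ^ 2 * g) =
      (∏ s ∈ range n, ((Fintype.card κ : ℝ) - (s + 1) + 2) * (Fintype.card κ - (s + 1))) *
        ((Fintype.card κ + e + 2) * (Fintype.card κ + e)) * gaussE (Fin (n + 1) × κ) g := by
  rw [sq, mul_assoc, gaussE_det_mul 2 e, gaussE_det_mul 0 e, prod_mul_distrib]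
  · have h : ∀ a b : ℝ, a + 2 - b = a - b + 2 := fun a b => by ring
    simp only [add_zero, h]
    ring
  · intro j s hs
    simp [hg j s hs]
  · rw [hg0, zero_add]
  · intro j s hs
    rw [Derivation.leibniz, hg j s hs, rowD_det_genericGram]
    split_ifs
    · simp only [smul_eq_mul, map_ofNat]
      ring
    · simp
  · rw [Derivation.leibniz, hg0, rowD_det_genericGram, if_pos rfl]
    simp only [smul_eq_mul, map_add, map_ofNat]
    ring

theorem rowD_genericGram_pow {n : ℕ} (m : ℕ) :
    (∀ j s, s ≠ 0 → rowD κ j s (genericGram (Fin (n + 1)) κ 0 0 ^ m) = 0) ∧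
      rowD κ 0 0 (genericGram (Fin (n + 1)) κ 0 0 ^ m) =
        C (2 * m : ℝ) * genericGram (Fin (n + 1)) κ 0 0 ^ m := by
  constructor
  · intro j s hs
    rw [Derivation.leibniz_pow, rowD_genericGram]
    simp [hs.symm]
  · rw [Derivation.leibniz_pow, rowD_genericGram]
    cases m with
    | zero => simp
    | succ m =>
      simp only [if_true, smul_eq_mul, Nat.add_sub_cancel, nsmul_eq_mul, map_mul, map_ofNat,
        map_natCast]
      ring

theorem gaussE_genericGram_pow {n : ℕ} (m : ℕ) :
    gaussE (Fin (n + 1) × κ) (genericGram (Fin (n + 1)) κ 0 0 ^ m) =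
      ∏ i ∈ range m, ((Fintype.card κ : ℝ) + 2 * i) := by
  induction m with
  | zero =>
    rw [pow_zero, ← MvPolynomial.C_1, ← MvPolynomial.monomial_zero', gaussE_monomial]
    simp [gaussMoment]
  | succ m ih =>
    rw [pow_succ', gaussE_genericGram_mul, (rowD_genericGram_pow m).2, C_mul', map_smul, ih,
      prod_range_succ, if_pos rfl, smul_eq_mul]
    ring

theorem gaussE_genericGram_det_sq_mul_pow (n : ℕ) :
    gaussE (Fin (n + 1) × κ) ((genericGram (Fin (n + 1)) κ).det ^ 2 *
      genericGram (Fin (n + 1)) κ 0 0 ^ (n + 1)) = muPoly (n + 1) (Fintype.card κ) := by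
  rw [gaussE_det_sq_mul _ _ (rowD_genericGram_pow _).1 (rowD_genericGram_pow _).2,
    gaussE_genericGram_pow, muPoly]
  set d : ℝ := (Fintype.card κ : ℝ)
  have h : (∏ i ∈ range (n + 1), (d + 2 * i)) * (d + 2 * (n + 1 : ℕ)) *
      (d + 2 * (n + 1 : ℕ) + 2) = d * (d + 2) * ∏ i ∈ range (n + 1), (d + 2 * i + 4) := by
    induction n + 1 with
    | zero => simp
    | succ m ih =>
      rw [prod_range_succ, prod_range_succ, ← mul_assoc (d * (d + 2)), ← ih]
      push_cast
      ring
  have h' : ∏ i ∈ range (n + 1), (d - i) * (d - i + 2) * (d + 2 * i + 4) =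
      (∏ s ∈ range n, (d - (s + 1) + 2) * (d - (s + 1))) * (d * (d + 2)) *
        ∏ i ∈ range (n + 1), (d + 2 * i + 4) := by
    rw [prod_mul_distrib, prod_range_succ']
    simp only [mul_comm (d - _ + 2), Nat.cast_add, Nat.cast_one, Nat.cast_zero, sub_zero]
  rw [h', mul_assoc _ (d * (d + 2)), ← h]
  push_cast
  ring

end RowOperator

theorem gaussE_genericGram_det_sq_mul_pow' (κ : Type*) [Fintype κ] (k : ℕ) [NeZero k] :
    gaussE (Fin k × κ) ((genericGram (Fin k) κ).det ^ 2 * genericGram (Fin k) κ 0 0 ^ k) =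
      muPoly k (Fintype.card κ) := by
  obtain ⟨n, rfl⟩ := Nat.exists_eq_succ_of_ne_zero (NeZero.ne k)
  exact gaussE_genericGram_det_sq_mul_pow n

section Contraction

theorem prod_eq_prod_lt {m : ℕ} {R : Type*} [CommMonoid R] {M : Equiv.Perm (Fin m)} (hM : IsPM M)
    (g : Fin m → R) : ∏ a, g a = ∏ a : {a // a < M a}, g a * g (M a) := by
  have hMM : ∀ a, M (M a) = a := fun a => congrArg (fun σ : Equiv.Perm (Fin m) => σ a) hM.1
  rw [← prod_subtype (univ.filter fun a => a < M a) (by simp) fun a => g a * g (M a),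
    prod_mul_distrib, ← prod_filter_mul_prod_filter_not univ fun a => a < M a]
  congr 1
  refine prod_nbij' M M ?_ ?_ ?_ ?_ ?_
  · intro a ha
    simp only [mem_filter_univ, hMM] at ha ⊢
    exact lt_of_le_of_ne (not_lt.1 ha) (hM.2 a)
  · intro a ha
    simp only [mem_filter_univ, hMM] at ha ⊢
    exact ha.not_gt
  all_goals simp [hMM]

/-- Summing over the colourings that are constant on the edges of a matching contracts the rows
along these edges. -/
theorem sum_invariant_prod {m : ℕ} {ι κ R : Type*} [Fintype κ] [DecidableEq κ] [CommRing R]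
    {M : Equiv.Perm (Fin m)} (hM : IsPM M) (φ : Fin m → ι) (X : ι → κ → R) :
    ∑ ψ : Fin m → κ, (if ∀ a, ψ (M a) = ψ a then ∏ a, X (φ a) (ψ a) else 0) =
      ∏ a : {a // a < M a}, ∑ l, X (φ a) l * X (φ (M a)) l := by
  have hMM : ∀ a, M (M a) = a := fun a => congrArg (fun σ : Equiv.Perm (Fin m) => σ a) hM.1
  have hlt : ∀ a, ¬ a < M a → M a < M (M a) := fun a ha => by
    rw [hMM]
    exact lt_of_le_of_ne (not_lt.1 ha) (hM.2 a)
  rw [prod_univ_sum, Fintype.piFinset_univ, ← sum_filter]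
  refine sum_bij' (fun ψ _ a => ψ a)
    (fun f _ a => if h : a < M a then f ⟨a, h⟩ else f ⟨M a, hlt a h⟩) ?_ ?_ ?_ ?_ ?_
  · simp
  · intro f _
    rw [mem_filter_univ]
    intro a
    dsimp only
    by_cases h : a < M a
    · have h' : ¬ M a < M (M a) := by
        rw [hMM]
        exact h.not_gt
      rw [dif_pos h, dif_neg h']
      simp only [hMM]
    · rw [dif_neg h, dif_pos (hlt a h)]
  · intro ψ hψ
    rw [mem_filter_univ] at hψ
    funext a
    simp only
    split_ifs
    · rfl
    · exact hψ a
  · intro f _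
    funext a
    simp [a.2]
  · intro ψ hψ
    rw [mem_filter_univ] at hψ
    rw [prod_eq_prod_lt hM]
    simp only [hψ]

end Contraction

/-- The point in position `p.2` of block `p.1`. -/
def blkEquiv (k : ℕ) : Fin (2 * k) × Fin 3 ≃ Fin (6 * k) where
  toFun p := blk p.1 p.2
  invFun a := (⟨a / 3, by omega⟩, ⟨a % 3, by omega⟩)
  left_inv p := by
    ext <;> simp only [blk] <;> omega
  right_inv a := by
    ext
    simp only [blk]
    omega

/-- The blocks, split into two halves of size `k`. -/
def slot (k : ℕ) : (Fin 2 × Fin k) × Fin 3 ≃ Fin (6 * k) :=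
  (finProdFinEquiv.prodCongr (Equiv.refl _)).trans (blkEquiv k)

section HessForm

variable {k : ℕ} [NeZero k] {R : Type*} [CommRing R]

/-- The multilinear form polarizing the square of the Hessian of a cubic form, evaluated at the
first basis vector. -/
def hessForm (Y : Fin k → Fin (6 * k) → R) : R :=
  ∏ s : Fin 2, (Matrix.of fun i j => Y i (slot k ((s, j), 0))).det *
    (Matrix.of fun i j => Y i (slot k ((s, j), 1))).det * ∏ j, Y 0 (slot k ((s, j), 2))

/-- The words occurring in the expansion of `hessForm`. -/
def hessWord (t : Fin 2 → Equiv.Perm (Fin k) × Equiv.Perm (Fin k)) (a : Fin (6 * k)) : Fin k :=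
  let p := (slot k).symm a
  ![(t p.1.1).1 p.1.2, (t p.1.1).2 p.1.2, 0] p.2

/-- The sign with which a word occurs in the expansion of `hessForm`. -/
def hessSign (t : Fin 2 → Equiv.Perm (Fin k) × Equiv.Perm (Fin k)) : ℤ :=
  ∏ s, (Equiv.Perm.sign (t s).1 : ℤ) * Equiv.Perm.sign (t s).2

theorem hessForm_eq_sum (Y : Fin k → Fin (6 * k) → R) :
    hessForm Y = ∑ t, (hessSign t : R) * ∏ a, Y (hessWord t a) a := by
  have h : ∀ s : Fin 2, (Matrix.of fun i j => Y i (slot k ((s, j), 0))).det *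
      (Matrix.of fun i j => Y i (slot k ((s, j), 1))).det * ∏ j, Y 0 (slot k ((s, j), 2)) =
      ∑ p : Equiv.Perm (Fin k) × Equiv.Perm (Fin k),
        (Equiv.Perm.sign p.1 : ℤ) * (Equiv.Perm.sign p.2 : ℤ) *
        ∏ j, (Y (p.1 j) (slot k ((s, j), 0)) * Y (p.2 j) (slot k ((s, j), 1)) *
          Y 0 (slot k ((s, j), 2))) := by
    intro s
    rw [Matrix.det_apply', Matrix.det_apply', sum_mul_sum, sum_mul, Fintype.sum_prod_type]
    refine sum_congr rfl fun σ _ => ?_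
    rw [sum_mul]
    refine sum_congr rfl fun τ _ => ?_
    simp only [Matrix.of_apply, prod_mul_distrib]
    ring
  rw [hessForm, prod_congr rfl fun s _ => h s, prod_univ_sum, Fintype.piFinset_univ]
  refine sum_congr rfl fun t _ => ?_
  rw [prod_mul_distrib, hessSign, ← (slot k).prod_comp, Fintype.prod_prod_type,
    Fintype.prod_prod_type]
  congr 1
  · push_cast
    rfl
  · refine prod_congr rfl fun s _ => prod_congr rfl fun j _ => ?_
    simp [Fin.prod_univ_three, hessWord]

/-- The value on a matching of the invariant vector obtained by contracting `hessForm`. -/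
def hessVec (N : Equiv.Perm (Fin (6 * k))) : ℝ :=
  ∑ t, (hessSign t : ℝ) * if ∀ a, hessWord t (N a) = hessWord t a then 1 else 0

/-- The contraction of `hessForm` along the edges of `M`. -/
def hessContract {κ : Type*} [Fintype κ] [DecidableEq κ] (M : Equiv.Perm (Fin (6 * k)))
    (X : Fin k → κ → R) : R :=
  ∑ ψ : Fin (6 * k) → κ, if ∀ a, ψ (M a) = ψ a then hessForm fun i a => X i (ψ a) else 0

theorem hessContract_eq_sum {κ : Type*} [Fintype κ] [DecidableEq κ]
    {M : Equiv.Perm (Fin (6 * k))} (hM : IsPM M) (X : Fin k → κ → R) :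
    hessContract M X = ∑ t, (hessSign t : R) *
      ∏ a : {a // a < M a}, ∑ l, X (hessWord t a) l * X (hessWord t (M a)) l := by
  simp only [← sum_invariant_prod hM, mul_sum]
  rw [sum_comm, hessContract]
  refine sum_congr rfl fun ψ _ => ?_
  split_ifs
  · rw [hessForm_eq_sum]
  · simp

theorem hessContract_congr {κ κ' : Type*} [Fintype κ] [DecidableEq κ] [Fintype κ']
    [DecidableEq κ'] {M : Equiv.Perm (Fin (6 * k))} (hM : IsPM M) (X : Fin k → κ → R)
    (X' : Fin k → κ' → R) (h : ∀ i j, ∑ l, X i l * X j l = ∑ l, X' i l * X' j l) :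
    hessContract M X = hessContract M X' := by
  rw [hessContract_eq_sum hM, hessContract_eq_sum hM]
  simp only [h]

theorem hessContract_of_row_zero (M : Equiv.Perm (Fin (6 * k))) (L : Matrix (Fin k) (Fin k) ℝ)
    (hL : ∀ j, j ≠ 0 → L 0 j = 0) :
    hessContract M L = L.det ^ 4 * L 0 0 ^ (2 * k) * hessVec M := by
  have h1 : ∀ (ψ : Fin (6 * k) → Fin k) (s : Fin 2) (c : Fin 3),
      (Matrix.of fun i j => L i (ψ (slot k ((s, j), c)))).det = L.det *
        (Matrix.of fun i j => if i = ψ (slot k ((s, j), c)) then (1 : ℝ) else 0).det := by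
    intro ψ s c
    rw [← Matrix.det_mul]
    congr 1
    ext i j
    simp [Matrix.mul_apply]
  have h2 : ∀ i, L 0 i = L 0 0 * if 0 = i then 1 else 0 := by
    intro i
    by_cases h : i = 0
    · simp [h]
    · simp [hL i h, Ne.symm h]
  have h3 : ∀ ψ : Fin (6 * k) → Fin k, hessForm (fun i a => L i (ψ a)) =
      L.det ^ 4 * L 0 0 ^ (2 * k) * hessForm fun i a => if i = ψ a then (1 : ℝ) else 0 := by
    intro ψ
    simp only [hessForm, h1, h2 (ψ _), prod_mul_distrib, prod_const, card_univ, Fintype.card_fin]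
    ring
  simp only [hessContract, h3, hessForm_eq_sum, hessVec, mul_sum]
  simp only [← mul_ite_zero, ← mul_sum]
  congr 1
  have h4 : ∀ (t : Fin 2 → Equiv.Perm (Fin k) × Equiv.Perm (Fin k)) (ψ : Fin (6 * k) → Fin k),
      (∏ a, if hessWord t a = ψ a then (1 : ℝ) else 0) = if hessWord t = ψ then 1 else 0 := by
    intro t ψ
    rw [prod_ite_zero, prod_const_one]
    simp [funext_iff]
  simp only [h4, ← sum_filter]
  rw [sum_comm]
  refine sum_congr rfl fun t _ => ?_
  simp only [mul_ite, mul_one, mul_zero, sum_ite_eq, mem_filter_univ]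

end HessForm

section Factorization

open MvPolynomial

variable {k : ℕ}

theorem eval_genericGram {κ : Type*} [Fintype κ] (x : Fin k × κ → ℝ) :
    (genericGram (Fin k) κ).map (eval x) =
      (Matrix.of fun i l => x (i, l)) * (Matrix.of fun i l => x (i, l)).transpose := by
  ext i j
  simp [genericGram, Matrix.mul_apply]

theorem eval_det_genericGram {κ : Type*} [Fintype κ] (x : Fin k × κ → ℝ) :
    eval x (genericGram (Fin k) κ).det =
      ((Matrix.of fun i l => x (i, l)) * (Matrix.of fun i l => x (i, l)).transpose).det := by
  rw [RingHom.map_det, RingHom.mapMatrix_apply, eval_genericGram]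

theorem det_genericGram_ne_zero {d : ℕ} (hd : k ≤ d) : (genericGram (Fin k) (Fin d)).det ≠ 0 := by
  intro h
  have h1 := congrArg (eval fun p : Fin k × Fin d => if p.2.val = p.1.val then (1 : ℝ) else 0) h
  rw [eval_det_genericGram, map_zero] at h1
  have h2 : (Matrix.of fun (i : Fin k) (l : Fin d) => if l.val = i.val then (1 : ℝ) else 0) *
      (Matrix.of fun (i : Fin k) (l : Fin d) => if l.val = i.val then (1 : ℝ) else 0).transpose
      = 1 := by
    ext i j
    rw [Matrix.mul_apply, Fintype.sum_eq_single (Fin.castLE hd i)]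
    · simp [Matrix.one_apply, Fin.ext_iff]
    · intro l hl
      have : l.val ≠ i.val := fun h => hl (Fin.ext h)
      simp [this]
  rw [h2, Matrix.det_one] at h1
  exact one_ne_zero h1

variable [NeZero k]

/-- A positive definite matrix is `L * Lᵀ` with `L` supported on the diagonal in its first row. -/
theorem exists_mul_transpose_eq {S : Matrix (Fin k) (Fin k) ℝ} (hS : S.PosDef) :
    ∃ L : Matrix (Fin k) (Fin k) ℝ, L * L.transpose = S ∧ ∀ j, j ≠ 0 → L 0 j = 0 := by
  have hrow : ∀ j : Fin k, j ≠ 0 → LDL.lower hS 0 j = 0 := by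
    intro j hj
    have hU : ∀ i : Fin k, i ≠ 0 → LDL.lowerInv hS 0 i = 0 := fun i hi =>
      LDL.lowerInv_triangular hS (Fin.pos_iff_ne_zero.2 hi)
    have h1 : LDL.lowerInv hS * LDL.lower hS = 1 := Matrix.mul_inv_of_invertible _
    have h2 : ∀ i, LDL.lowerInv hS 0 0 * LDL.lower hS 0 i = (1 : Matrix (Fin k) (Fin k) ℝ) 0 i := by
      intro i
      rw [← h1, Matrix.mul_apply, Fintype.sum_eq_single 0]
      intro l hl
      rw [hU l hl, zero_mul]
    have h3 := h2 0
    have h4 := h2 j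
    rw [Matrix.one_apply_eq] at h3
    rw [Matrix.one_apply_ne hj.symm] at h4
    exact (mul_eq_zero.1 h4).resolve_left (left_ne_zero_of_mul_eq_one h3)
  have hD : (LDL.diag hS).PosDef := by
    rw [LDL.diag_eq_lowerInv_conj]
    exact hS.mul_mul_conjTranspose_same
      (Matrix.vecMul_injective_of_isUnit (isUnit_of_invertible _))
  have hpos : ∀ i, 0 ≤ LDL.diagEntries hS i := fun i => by
    have := (Matrix.posDef_diagonal_iff.1 hD i).le
    exact this
  refine ⟨LDL.lower hS * Matrix.diagonal fun i => √(LDL.diagEntries hS i), ?_, ?_⟩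
  · rw [Matrix.transpose_mul, Matrix.diagonal_transpose, Matrix.mul_assoc,
      ← Matrix.mul_assoc (Matrix.diagonal _), Matrix.diagonal_mul_diagonal]
    simp only [Real.mul_self_sqrt (hpos _)]
    rw [← Matrix.mul_assoc, ← Matrix.conjTranspose_eq_transpose_of_trivial]
    exact LDL.lower_conj_diag hS
  · intro j hj
    rw [Matrix.mul_diagonal, hrow j hj, zero_mul]

theorem hessContract_of_posDef {κ : Type*} [Fintype κ] [DecidableEq κ]
    {M : Equiv.Perm (Fin (6 * k))} (hM : IsPM M) (X : Matrix (Fin k) κ ℝ)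
    (hX : (X * X.transpose).PosDef) :
    hessContract M X =
      (X * X.transpose).det ^ 2 * (X * X.transpose) 0 0 ^ k * hessVec M := by
  obtain ⟨L, hL, hL0⟩ := exists_mul_transpose_eq hX
  rw [hessContract_congr hM X L fun i j => congrFun (congrFun hL.symm i) j,
    hessContract_of_row_zero M L hL0, ← hL, Matrix.det_mul, Matrix.det_transpose,
    Matrix.mul_apply, Fintype.sum_eq_single 0 fun j hj => by rw [hL0 j hj, zero_mul],
    Matrix.transpose_apply]
  ring

theorem map_hessForm {R S : Type*} [CommRing R] [CommRing S] (f : R →+* S)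
    (Y : Fin k → Fin (6 * k) → R) : f (hessForm Y) = hessForm fun i a => f (Y i a) := by
  simp only [hessForm_eq_sum, map_sum, map_mul, map_prod, map_intCast]

theorem map_hessContract {R S κ : Type*} [CommRing R] [CommRing S] [Fintype κ] [DecidableEq κ]
    (f : R →+* S) (M : Equiv.Perm (Fin (6 * k))) (X : Fin k → κ → R) :
    f (hessContract M X) = hessContract M fun i l => f (X i l) := by
  rw [hessContract, map_sum]
  refine sum_congr rfl fun ψ _ => ?_
  split_ifs
  · exact map_hessForm f _
  · exact map_zero f

theorem hessContract_X {d : ℕ} (hd : k ≤ d) {M : Equiv.Perm (Fin (6 * k))} (hM : IsPM M) :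
    hessContract M (fun i l => (X (i, l) : MvPolynomial (Fin k × Fin d) ℝ)) =
      C (hessVec M) *
        ((genericGram (Fin k) (Fin d)).det ^ 2 * genericGram (Fin k) (Fin d) 0 0 ^ k) := by
  refine mul_left_cancel₀ (det_genericGram_ne_zero hd) (MvPolynomial.funext fun x => ?_)
  rw [map_mul, map_mul, eval_det_genericGram, map_hessContract]
  set Y : Matrix (Fin k) (Fin d) ℝ := Matrix.of fun i l => x (i, l) with hY
  by_cases h0 : (Y * Y.transpose).det = 0
  · rw [h0, zero_mul, zero_mul]
  congr 1
  have hpos : (Y * Y.transpose).PosDef := by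
    rw [← Matrix.conjTranspose_eq_transpose_of_trivial] at h0 ⊢
    exact (Matrix.posSemidef_self_mul_conjTranspose Y).posDef_iff_isUnit.2
      ((Matrix.isUnit_iff_isUnit_det _).2 (isUnit_iff_ne_zero.2 h0))
  have h := hessContract_of_posDef hM Y hpos
  simp only [eval_X, map_mul, map_pow, eval_det_genericGram, eval_C, ← hY]
  have h00 : eval x (genericGram (Fin k) (Fin d) 0 0) = (Y * Y.transpose) 0 0 := by
    rw [← eval_genericGram]
    rfl
  rw [h00, mul_comm (hessVec M)]
  exact h

end Factorization

/-- The number of orbits is determined by the number of colourings constant on orbits. -/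
theorem pow_numOrbits (d : ℕ) {m : ℕ} (M N : Equiv.Perm (Fin m)) :
    (d : ℝ) ^ numOrbits M N = ∑ ψ : Fin m → Fin d,
      if (∀ a, ψ (M a) = ψ a) ∧ ∀ a, ψ (N a) = ψ a then 1 else 0 := by
  classical
  have hinv : ∀ ψ : Fin m → Fin d, ((∀ a, ψ (M a) = ψ a) ∧ ∀ a, ψ (N a) = ψ a) ↔
      ∀ g ∈ Subgroup.closure {M, N}, ∀ a, ψ (g a) = ψ a := by
    intro ψ
    constructor
    · intro h g hg
      induction hg using Subgroup.closure_induction with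
      | mem g hg =>
        rcases hg with rfl | rfl
        · exact h.1
        · exact h.2
      | one => exact fun a => rfl
      | mul g g' _ _ h1 h2 => exact fun a => by rw [Equiv.Perm.mul_apply, h1, h2]
      | inv g _ h1 => exact fun a => by simpa using (h1 (g⁻¹ a)).symm
    · exact fun h => ⟨h M (Subgroup.subset_closure (by simp)),
        h N (Subgroup.subset_closure (by simp))⟩
  let e : (MulAction.orbitRel.Quotient (Subgroup.closure {M, N}) (Fin m) → Fin d) ≃
      {ψ : Fin m → Fin d // ∀ g ∈ Subgroup.closure {M, N}, ∀ a, ψ (g a) = ψ a} :=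
    { toFun := fun f => ⟨fun a => f (Quotient.mk'' a), fun g hg a =>
        congrArg f (Quotient.sound' ⟨⟨g, hg⟩, rfl⟩)⟩
      invFun := fun ψ q => Quotient.liftOn' q ψ.1 fun a b ⟨g, hg⟩ => by
        rw [← hg]
        exact ψ.2 g g.2 b
      left_inv := fun f => by
        funext q
        induction q using Quotient.inductionOn'
        rfl
      right_inv := fun ψ => rfl }
  have hc := Nat.card_congr e
  rw [Nat.card_fun, Nat.card_fin, Nat.subtype_card _ fun _ => mem_filter_univ _] at hc
  simp only [hinv]
  rw [sum_boole, ← hc, Nat.cast_pow]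
  rfl

theorem numOrbits_conj {m : ℕ} (q M N : Equiv.Perm (Fin m)) :
    numOrbits (q * M * q⁻¹) (q * N * q⁻¹) = numOrbits M N := by
  have h : ((2 : ℕ) : ℝ) ^ numOrbits (q * M * q⁻¹) (q * N * q⁻¹) =
      ((2 : ℕ) : ℝ) ^ numOrbits M N := by
    rw [pow_numOrbits, pow_numOrbits]
    refine Fintype.sum_equiv (q.symm.arrowCongr (Equiv.refl _)) _ _ fun ψ => ?_
    simp only [Equiv.arrowCongr_apply, Equiv.symm_symm, Equiv.coe_refl, Function.comp_apply, id,
      Equiv.Perm.mul_apply]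
    congr 2
    · exact propext ⟨fun h a => by simpa using h (q a), fun h a => by simpa using h (q⁻¹ a)⟩
    · exact propext ⟨fun h a => by simpa using h (q a), fun h a => by simpa using h (q⁻¹ a)⟩
  exact Nat.pow_right_injective le_rfl (by exact_mod_cast h)

section Eigenvector

open MvPolynomial

variable {k : ℕ} [NeZero k]

theorem gaussE_hessForm {κ : Type*} [Fintype κ] [DecidableEq κ] (ψ : Fin (6 * k) → κ) :
    gaussE (Fin k × κ) (hessForm fun i a => X (i, ψ a)) =
      ∑ N : {N : Equiv.Perm (Fin (6 * k)) // IsPM N},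
        hessVec N.1 * if ∀ a, ψ (N.1 a) = ψ a then 1 else 0 := by
  have h : ∀ t, gaussE (Fin k × κ) ((hessSign t : MvPolynomial (Fin k × κ) ℝ) *
      ∏ a, X (hessWord t a, ψ a)) = ∑ N : {N : Equiv.Perm (Fin (6 * k)) // IsPM N},
        (hessSign t : ℝ) * (if ∀ a, hessWord t (N.1 a) = hessWord t a then 1 else 0) *
          if ∀ a, ψ (N.1 a) = ψ a then 1 else 0 := by
    intro t
    rw [← map_intCast (C : ℝ →+* MvPolynomial (Fin k × κ) ℝ), C_mul', map_smul, smul_eq_mul,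
      gaussE_prod_X_eq_sum fun a => (hessWord t a, ψ a), mul_sum]
    simp only [Prod.mk.injEq, forall_and, mul_assoc, ite_zero_mul_ite_zero, mul_one]
  rw [hessForm_eq_sum, map_sum, sum_congr rfl fun t _ => h t, sum_comm]
  simp only [hessVec, sum_mul]

theorem sum_natCast_pow_numOrbits_mul_hessVec {d : ℕ} (hd : k ≤ d)
    {M : Equiv.Perm (Fin (6 * k))} (hM : IsPM M) :
    ∑ N : {N : Equiv.Perm (Fin (6 * k)) // IsPM N}, (d : ℝ) ^ numOrbits M N.1 * hessVec N.1 =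
      muPoly k d * hessVec M := by
  have h := congrArg (gaussE (Fin k × Fin d)) (hessContract_X hd hM)
  rw [C_mul', map_smul, smul_eq_mul, gaussE_genericGram_det_sq_mul_pow', Fintype.card_fin,
    mul_comm, hessContract, map_sum] at h
  rw [← h]
  simp only [apply_ite, map_zero, gaussE_hessForm, pow_numOrbits, sum_mul]
  rw [sum_comm]
  refine sum_congr rfl fun ψ _ => ?_
  split_ifs with hψ
  · exact sum_congr rfl fun N _ => by simp [hψ, mul_comm]
  · exact sum_eq_zero fun N _ => by simp [hψ]

theorem sum_pow_numOrbits_mul_hessVec (x : ℝ) {M : Equiv.Perm (Fin (6 * k))} (hM : IsPM M) :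
    ∑ N : {N : Equiv.Perm (Fin (6 * k)) // IsPM N}, x ^ numOrbits M N.1 * hessVec N.1 =
      muPoly k x * hessVec M := by
  let p : Polynomial ℝ :=
    (∑ N : {N : Equiv.Perm (Fin (6 * k)) // IsPM N},
      Polynomial.X ^ numOrbits M N.1 * Polynomial.C (hessVec N.1)) -
    (∏ i ∈ range k, (Polynomial.X - Polynomial.C (i : ℝ)) *
      (Polynomial.X - Polynomial.C (i : ℝ) + Polynomial.C 2) *
      (Polynomial.X + Polynomial.C (2 * (i : ℝ)) + Polynomial.C 4)) * Polynomial.C (hessVec M)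
  have hp : ∀ y, p.eval y = (∑ N : {N : Equiv.Perm (Fin (6 * k)) // IsPM N},
      y ^ numOrbits M N.1 * hessVec N.1) - muPoly k y * hessVec M := by
    intro y
    simp only [p, Polynomial.eval_sub, Polynomial.eval_finsetSum, Polynomial.eval_mul,
      Polynomial.eval_prod, Polynomial.eval_pow, Polynomial.eval_add, Polynomial.eval_X,
      Polynomial.eval_C, muPoly]
  have h0 : p = 0 := by
    refine Polynomial.eq_zero_of_infinite_isRoot p ?_
    refine ((Set.Ici_infinite k).image (Nat.cast_injective (R := ℝ)).injOn).mono ?_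
    rintro _ ⟨d, hd, rfl⟩
    rw [Set.mem_ofPred_eq, Polynomial.IsRoot, hp, sum_natCast_pow_numOrbits_mul_hessVec hd hM,
      sub_self]
  rw [← sub_eq_zero, ← hp, h0, Polynomial.eval_zero]

end Eigenvector

section BlockGroup

variable {k : ℕ}

theorem mem_Qfin {q : Equiv.Perm (Fin (6 * k))} :
    q ∈ Qfin k ↔ ∃ (π : Equiv.Perm (Fin (2 * k))) (s : Fin (2 * k) → Fin 3),
      ∀ j i, q (blk j i) = blk (π j) (i + s j) := by
  rw [Qfin, Set.Finite.mem_toFinset]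
  constructor
  · rintro ⟨b, hb, d, ⟨π, hπ⟩, rfl⟩
    choose s hs using hb
    exact ⟨π, fun j => s (π j), fun j i => by rw [Equiv.Perm.mul_apply, hπ, hs]⟩
  · rintro ⟨π, s, h⟩
    let d := (blkEquiv k).permCongr (π.prodCongr (Equiv.refl _))
    have hd : ∀ j i, d (blk j i) = blk (π j) i := by
      intro j i
      change d (blkEquiv k (j, i)) = blkEquiv k (π j, i)
      simp [d, Equiv.permCongr_apply]
    refine ⟨q * d⁻¹, fun j => ⟨s (π⁻¹ j), fun i => ?_⟩, d, ⟨π, hd⟩, by simp⟩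
    have h1 : d⁻¹ (blk j i) = blk (π⁻¹ j) i := by
      rw [Equiv.Perm.inv_eq_iff_eq, hd]
      simp
    rw [Equiv.Perm.mul_apply, h1, h]
    simp

theorem mul_mem_Qfin {q r : Equiv.Perm (Fin (6 * k))} (hq : q ∈ Qfin k) (hr : r ∈ Qfin k) :
    q * r ∈ Qfin k := by
  obtain ⟨π, s, h⟩ := mem_Qfin.1 hq
  obtain ⟨ρ, t, h'⟩ := mem_Qfin.1 hr
  exact mem_Qfin.2 ⟨π * ρ, fun j => t j + s (ρ j), fun j i => by
    rw [Equiv.Perm.mul_apply, h', h, Equiv.Perm.mul_apply, add_assoc]⟩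

theorem inv_mem_Qfin {q : Equiv.Perm (Fin (6 * k))} (hq : q ∈ Qfin k) : q⁻¹ ∈ Qfin k := by
  obtain ⟨π, s, h⟩ := mem_Qfin.1 hq
  refine mem_Qfin.2 ⟨π⁻¹, fun j => -s (π⁻¹ j), fun j i => ?_⟩
  rw [Equiv.Perm.inv_eq_iff_eq, h]
  simp

theorem sum_Qfin_mul_right {R : Type*} [AddCommMonoid R] (f : Equiv.Perm (Fin (6 * k)) → R)
    {r : Equiv.Perm (Fin (6 * k))} (hr : r ∈ Qfin k) :
    ∑ q ∈ Qfin k, f (q * r) = ∑ q ∈ Qfin k, f q :=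
  sum_nbij' (· * r) (· * r⁻¹) (fun _ hq => mul_mem_Qfin hq hr)
    (fun _ hq => mul_mem_Qfin hq (inv_mem_Qfin hr)) (by simp) (by simp) (by simp)

theorem card_Qfin_pos (k : ℕ) : 0 < #(Qfin k) :=
  card_pos.2 ⟨1, mem_Qfin.2 ⟨1, 0, fun j i => by simp⟩⟩

end BlockGroup

theorem IsPM.conj {m : ℕ} {M : Equiv.Perm (Fin m)} (hM : IsPM M) (q : Equiv.Perm (Fin m)) :
    IsPM (q * M * q⁻¹) := by
  refine ⟨?_, fun a h => hM.2 (q⁻¹ a) ?_⟩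
  · rw [show q * M * q⁻¹ * (q * M * q⁻¹) = q * (M * M) * q⁻¹ by group, hM.1]
    group
  · rw [Equiv.Perm.eq_inv_iff_eq]
    exact h

/-- Conjugation by `q` as a permutation of the perfect matchings. -/
def conjPM {m : ℕ} (q : Equiv.Perm (Fin m)) : Equiv.Perm {M : Equiv.Perm (Fin m) // IsPM M} where
  toFun M := ⟨q * M.1 * q⁻¹, M.2.conj q⟩
  invFun M := ⟨q⁻¹ * M.1 * q⁻¹⁻¹, M.2.conj q⁻¹⟩
  left_inv M := Subtype.ext (by dsimp only; group)
  right_inv M := Subtype.ext (by dsimp only; group)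

section Symmetrization

variable {k : ℕ} [NeZero k]

/-- The average of `hessVec` over the conjugation action of `Q`, up to a scalar. -/
noncomputable def symVec (N : Equiv.Perm (Fin (6 * k))) : ℝ :=
  ∑ q ∈ Qfin k, hessVec (q * N * q⁻¹)

theorem symVec_conj {r : Equiv.Perm (Fin (6 * k))} (hr : r ∈ Qfin k)
    (N : Equiv.Perm (Fin (6 * k))) : symVec (r * N * r⁻¹) = symVec N := by
  rw [symVec, symVec, ← sum_Qfin_mul_right (fun q => hessVec (q * N * q⁻¹)) hr]
  simp only [mul_inv_rev, mul_assoc]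

theorem sum_pow_numOrbits_mul_symVec (x : ℝ) {M : Equiv.Perm (Fin (6 * k))} (hM : IsPM M) :
    ∑ N : {N : Equiv.Perm (Fin (6 * k)) // IsPM N}, x ^ numOrbits M N.1 * symVec N.1 =
      muPoly k x * symVec M := by
  simp only [symVec, mul_sum]
  rw [sum_comm]
  refine sum_congr rfl fun q _ => ?_
  rw [← sum_pow_numOrbits_mul_hessVec x (hM.conj q)]
  refine Fintype.sum_equiv (conjPM q) _ _ fun N => ?_
  simp only [conjPM, Equiv.coe_fn_mk, numOrbits_conj]

theorem AQ_mulVec_symVec (x : ℝ) :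
    (AQ k x).mulVec (fun N => symVec N.1) =
      (((Qfin k).card : ℝ) * muPoly k x) • fun N => symVec N.1 := by
  funext M
  simp only [Matrix.mulVec, dotProduct, AQ, Matrix.of_apply, sum_mul, Pi.smul_apply, smul_eq_mul]
  rw [sum_comm, mul_assoc, ← nsmul_eq_mul, ← sum_const]
  refine sum_congr rfl fun q hq => ?_
  rw [← sum_pow_numOrbits_mul_symVec x M.2]
  refine Fintype.sum_equiv (conjPM q) _ _ fun N => ?_
  simp only [conjPM, Equiv.coe_fn_mk, symVec_conj hq]

end Symmetrization

section Nonvanishing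

open MvPolynomial

/-- The number of colourings of the blocks that are constant along the edges of `N`. -/
noncomputable def blockColourings {k : ℕ} (N : Equiv.Perm (Fin (6 * k))) : ℝ :=
  ∑ ψ : Fin (2 * k) → Fin k,
    if ∀ a, ψ ((blkEquiv k).symm (N a)).1 = ψ ((blkEquiv k).symm a).1 then 1 else 0

theorem blockColourings_conj {k : ℕ} {q : Equiv.Perm (Fin (6 * k))} (hq : q ∈ Qfin k)
    (N : Equiv.Perm (Fin (6 * k))) : blockColourings (q * N * q⁻¹) = blockColourings N := by
  obtain ⟨π, s, h⟩ := mem_Qfin.1 hq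
  have h1 : ∀ a, ((blkEquiv k).symm (q a)).1 = π ((blkEquiv k).symm a).1 := by
    intro a
    obtain ⟨⟨j, i⟩, rfl⟩ := (blkEquiv k).surjective a
    have h2 : q (blkEquiv k (j, i)) = blkEquiv k (π j, i + s j) := h j i
    rw [h2, Equiv.symm_apply_apply, Equiv.symm_apply_apply]
  refine Fintype.sum_equiv (π.symm.arrowCongr (Equiv.refl _)) _ _ fun ψ => ?_
  congr 1
  refine propext ⟨fun H a => ?_, fun H a => ?_⟩
  · simpa [h1] using H (q a)
  · have := H (q⁻¹ a)
    simp only [Equiv.arrowCongr_apply, Function.comp_apply, Equiv.symm_symm, ← h1] at this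
    simpa using this

theorem sum_prod_mul_det {k : ℕ} {R : Type*} [CommRing R] (A : Matrix (Fin k) (Fin k) R)
    (b : Fin k → R) :
    ∑ f : Fin k → Fin k, (Matrix.of fun i j => A i (f j)).det ^ 2 * ∏ j, b (f j) =
      (k.factorial : R) * (A.det ^ 2 * ∏ j, b j) := by
  rw [← Fintype.sum_of_injective (fun σ : Equiv.Perm (Fin k) => (σ : Fin k → Fin k))
    DFunLike.coe_injective (fun _ => A.det ^ 2 * ∏ j, b j)]
  · simp [Fintype.card_perm]
  · intro f hf
    have hinj : ¬ Function.Injective f := fun h =>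
      hf ⟨Equiv.ofBijective f (Finite.injective_iff_bijective.1 h), rfl⟩
    simp only [Function.Injective, not_forall] at hinj
    obtain ⟨i, j, hij, hne⟩ := hinj
    rw [Matrix.det_zero_of_column_eq hne fun l => by simp [hij]]
    simp
  · intro σ
    have h : (Matrix.of fun i j => A i (σ j)) = A.submatrix id σ := rfl
    rw [h, Matrix.det_permute', Equiv.prod_comp σ b, mul_pow, ← Int.cast_pow]
    simp [← Units.val_pow_eq_pow_val]

theorem sum_hessForm {k : ℕ} [NeZero k] {R : Type*} [CommRing R] (A : Matrix (Fin k) (Fin k) R) :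
    ∑ ψ : Fin (2 * k) → Fin k, hessForm (fun i a => A i (ψ ((blkEquiv k).symm a).1)) =
      ((k.factorial : R) * (A.det ^ 2 * ∏ j, A 0 j)) ^ 2 := by
  rw [← sum_prod_mul_det, ← Fin.prod_const, prod_univ_sum, Fintype.piFinset_univ]
  refine Fintype.sum_equiv ((finProdFinEquiv.symm.arrowCongr (Equiv.refl _)).trans
    (Equiv.curry _ _ _)) _ _ fun ψ => ?_
  refine prod_congr rfl fun s _ => ?_
  simp [slot, sq, Function.curry]

theorem gaussE_prod_X_sq {n : ℕ} :
    gaussE (Fin (n + 1) × Fin (n + 1)) (∏ j, X ((0 : Fin (n + 1)), j) ^ 2) = 1 := by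
  have h : ∏ j, X ((0 : Fin (n + 1)), j) ^ 2 = monomial (R := ℝ)
      (∑ j : Fin (n + 1), Finsupp.single ((0 : Fin (n + 1)), j) 2) 1 := by
    rw [monomial_sum_one]
    exact prod_congr rfl fun j _ => X_pow_eq_monomial
  rw [h, gaussE_monomial, one_mul]
  refine prod_eq_one fun v _ => ?_
  obtain ⟨i, l⟩ := v
  rw [Finsupp.finsetSum_apply]
  simp only [Finsupp.single_apply, Prod.mk.injEq]
  by_cases hi : i = 0
  · simp [hi, gaussMoment]
  · simp [Ne.symm hi, gaussMoment]

theorem gaussE_sum_hessForm_pos (n : ℕ) :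
    0 < gaussE (Fin (n + 1) × Fin (n + 1)) (∑ ψ : Fin (2 * (n + 1)) → Fin (n + 1),
      hessForm fun i a => X (i, ψ ((blkEquiv (n + 1)).symm a).1)) := by
  let A : Matrix (Fin (n + 1)) (Fin (n + 1)) (MvPolynomial (Fin (n + 1) × Fin (n + 1)) ℝ) :=
    Matrix.of fun i j => X (i, j)
  have hA : genericGram (Fin (n + 1)) (Fin (n + 1)) = A * A.transpose := by
    ext1 i j
    simp [genericGram, A, Matrix.mul_apply]
  have hrow : ∀ s : Fin (n + 1), ∀ j, rowD (Fin (n + 1)) j s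
      (∏ l, X ((0 : Fin (n + 1)), l) ^ 2) = ∑ l, (∏ m ∈ univ.erase l, X (0, m) ^ 2) *
        (2 * X (0, l) * if 0 = s then X (j, l) else 0) := by
    intro s j
    rw [Derivation.map_prod]
    refine sum_congr rfl fun l _ => ?_
    simp [Derivation.leibniz_pow, rowD_X, mul_assoc]
  have h : (∑ ψ : Fin (2 * (n + 1)) → Fin (n + 1),
      hessForm fun i a => (X (i, ψ ((blkEquiv (n + 1)).symm a).1) :
        MvPolynomial (Fin (n + 1) × Fin (n + 1)) ℝ)) = C (((n + 1).factorial : ℝ) ^ 2) *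
      ((genericGram (Fin (n + 1)) (Fin (n + 1))).det ^ 2 * ∏ l, X (0, l) ^ 2) := by
    rw [show (∑ ψ : Fin (2 * (n + 1)) → Fin (n + 1),
      hessForm fun i a => (X (i, ψ ((blkEquiv (n + 1)).symm a).1) :
        MvPolynomial (Fin (n + 1) × Fin (n + 1)) ℝ)) = _ from sum_hessForm A, hA, Matrix.det_mul,
      Matrix.det_transpose, prod_pow, map_pow, map_natCast]
    simp only [A, Matrix.of_apply]
    ring
  rw [h, C_mul', map_smul, smul_eq_mul, gaussE_det_sq_mul (2 * (n + 1)), gaussE_prod_X_sq,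
    Fintype.card_fin]
  · refine mul_pos (by positivity) (mul_pos (mul_pos (prod_pos fun s hs => ?_) ?_) one_pos)
    · have : (s : ℝ) < n := by exact_mod_cast mem_range.1 hs
      push_cast
      exact mul_pos (by linarith) (by linarith)
    · positivity
  · intro j s hs
    simp [hrow, hs.symm]
  · have hl : ∀ l : Fin (n + 1), (∏ m ∈ univ.erase l, X (0, m) ^ 2) *
        (2 * X (0, l) * X (0, l)) = 2 * ∏ m, (X ((0 : Fin (n + 1)), m) ^ 2 :
          MvPolynomial (Fin (n + 1) × Fin (n + 1)) ℝ) := by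
      intro l
      rw [← mul_prod_erase univ _ (mem_univ l)]
      ring
    rw [hrow]
    simp only [if_true, hl, sum_const, card_univ, Fintype.card_fin, nsmul_eq_mul, C_mul, C_add,
      map_natCast, map_ofNat, map_one]
    push_cast
    ring

theorem symVec_ne_zero (k : ℕ) [NeZero k] :
    (fun N : {N : Equiv.Perm (Fin (6 * k)) // IsPM N} => symVec N.1) ≠ 0 := by
  intro h0
  have hpos : 0 < ∑ N : {N : Equiv.Perm (Fin (6 * k)) // IsPM N},
      hessVec N.1 * blockColourings N.1 := by
    obtain ⟨n, rfl⟩ := Nat.exists_eq_succ_of_ne_zero (NeZero.ne k)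
    have h := gaussE_sum_hessForm_pos n
    simp only [map_sum, gaussE_hessForm] at h
    rw [sum_comm] at h
    simpa only [blockColourings, mul_sum] using h
  have h1 : ∑ N : {N : Equiv.Perm (Fin (6 * k)) // IsPM N}, symVec N.1 * blockColourings N.1 =
      #(Qfin k) * ∑ N : {N : Equiv.Perm (Fin (6 * k)) // IsPM N},
        hessVec N.1 * blockColourings N.1 := by
    simp only [symVec, sum_mul]
    rw [sum_comm, ← nsmul_eq_mul, ← sum_const]
    refine sum_congr rfl fun q hq => Fintype.sum_equiv (conjPM q) _ _ fun N => ?_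
    simp only [conjPM, Equiv.coe_fn_mk, blockColourings_conj hq]
  have h2 : ∀ N : {N : Equiv.Perm (Fin (6 * k)) // IsPM N}, symVec N.1 = 0 := congrFun h0
  simp only [h2, zero_mul, sum_const_zero] at h1
  exact (mul_pos (Nat.cast_pos.2 (card_Qfin_pos k)) hpos).ne h1

end Nonvanishing

theorem stmt4 (k : ℕ) (hk : 1 ≤ k) (x : ℝ) :
    ∃ u : {M : Equiv.Perm (Fin (6 * k)) // IsPM M} → ℝ, u ≠ 0 ∧
      (AQ k x).mulVec u = (((Qfin k).card : ℝ) * muPoly k x) • u := by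
  have : NeZero k := ⟨Nat.one_le_iff_ne_zero.1 hk⟩
  exact ⟨fun N => symVec N.1, symVec_ne_zero k, AQ_mulVec_symVec x⟩
end
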